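/- (Lemma 1, state distribution discrepancy bound.) In a finite discounted MDP, let π^g and π^r be stationary policies, T : S → [0,1] an intervention function, and π^b(a|s) = T(s)·π^g(a|s) + (1−T(s))·π^r(a|s) the induced behavior policy. Assume E_{s∼d_{π^b}}‖π^g(·|s) − π^r(·|s)‖₁ > 0 and define the weighted intervention rate β = E_{s∼d_{π^b}}[T(s)·‖π^g(·|s) − π^r(·|s)‖₁] / E_{s∼d_{π^b}}‖π^g(·|s) − π^r(·|s)‖₁ ∈ [0,1]. Then the discrepancy between the discounted state visitation distributions of π^b and π^r is bounded by ‖d_{π^b} − d_{π^r}‖₁ ≤ (βγ/(1−γ)) · E_{s∼d_{π^b}}‖π^g(·|s) − π^r(·|s)‖₁, where ‖·‖₁ denotes the total variation (ℓ¹) norm over the finite state or action space. -/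

import Mathlib

open scoped BigOperators

/-- The state distribution at time `t` induced by starting from `ρ` and following
policy `π` in an MDP with transition function `P`. -/
noncomputable def stateDist {S A : Type*} [Fintype S] [Fintype A]
    (P : S → A → S → ℝ) (π : S → A → ℝ) (ρ : S → ℝ) : ℕ → S → ℝ
  | 0 => ρ
  | t + 1 => fun s' => ∑ s : S, ∑ a : A, stateDist P π ρ t s * π s a * P s a s'

/-- The normalized discounted state visitation distribution
`d_π(s) = (1-γ) ∑_{t≥0} γ^t Pr(s_t = s)`. -/
noncomputable def dvisit {S A : Type*} [Fintype S] [Fintype A]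
    (γ : ℝ) (P : S → A → S → ℝ) (π : S → A → ℝ) (ρ : S → ℝ) (s : S) : ℝ :=
  (1 - γ) * ∑' t : ℕ, γ ^ t * stateDist P π ρ t s

section stateDist

variable {S A : Type*} [Fintype S] [Fintype A] {P : S → A → S → ℝ} {π : S → A → ℝ} {ρ : S → ℝ}

theorem stateDist_nonneg (hP0 : ∀ s a s', 0 ≤ P s a s') (hπ0 : ∀ s a, 0 ≤ π s a)
    (hρ0 : ∀ s, 0 ≤ ρ s) (t : ℕ) (s : S) : 0 ≤ stateDist P π ρ t s := by
  induction t generalizing s with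
  | zero => exact hρ0 s
  | succ t ih =>
    exact Finset.sum_nonneg fun x _ => Finset.sum_nonneg fun a _ =>
      mul_nonneg (mul_nonneg (ih x) (hπ0 x a)) (hP0 x a s)

theorem sum_sum_sum_mul_transition (hP1 : ∀ s a, ∑ s', P s a s' = 1) (f : S → A → ℝ) :
    ∑ s', ∑ s, ∑ a, f s a * P s a s' = ∑ s, ∑ a, f s a := by
  rw [Finset.sum_comm]
  refine Finset.sum_congr rfl fun s _ => ?_
  rw [Finset.sum_comm]
  simp [← Finset.mul_sum, hP1]

theorem sum_abs_sum_sum_mul_transition_le (hP0 : ∀ s a s', 0 ≤ P s a s')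
    (hP1 : ∀ s a, ∑ s', P s a s' = 1) (f : S → A → ℝ) :
    ∑ s', |∑ s, ∑ a, f s a * P s a s'| ≤ ∑ s, ∑ a, |f s a| := by
  rw [← sum_sum_sum_mul_transition hP1 fun s a => |f s a|]
  refine Finset.sum_le_sum fun s' _ => (Finset.abs_sum_le_sum_abs _ _).trans ?_
  refine Finset.sum_le_sum fun s _ => (Finset.abs_sum_le_sum_abs _ _).trans ?_
  exact Finset.sum_le_sum fun a _ => by rw [abs_mul, abs_of_nonneg (hP0 s a s')]

theorem sum_stateDist (hP1 : ∀ s a, ∑ s', P s a s' = 1) (hπ1 : ∀ s, ∑ a, π s a = 1)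
    (hρ1 : ∑ s, ρ s = 1) (t : ℕ) : ∑ s, stateDist P π ρ t s = 1 := by
  induction t with
  | zero => exact hρ1
  | succ t ih =>
    simp only [stateDist]
    rw [sum_sum_sum_mul_transition hP1 fun s a => stateDist P π ρ t s * π s a]
    simp [← Finset.mul_sum, hπ1, ih]

variable {γ : ℝ}

theorem summable_pow_mul_stateDist (hγ0 : 0 ≤ γ) (hγ1 : γ < 1)
    (hP0 : ∀ s a s', 0 ≤ P s a s') (hP1 : ∀ s a, ∑ s', P s a s' = 1)
    (hρ0 : ∀ s, 0 ≤ ρ s) (hρ1 : ∑ s, ρ s = 1)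
    (hπ0 : ∀ s a, 0 ≤ π s a) (hπ1 : ∀ s, ∑ a, π s a = 1) (s : S) :
    Summable fun t : ℕ => γ ^ t * stateDist P π ρ t s := by
  have hnn := stateDist_nonneg hP0 hπ0 hρ0
  refine (summable_geometric_of_lt_one hγ0 hγ1).of_nonneg_of_le
    (fun t => mul_nonneg (pow_nonneg hγ0 t) (hnn t s))
    fun t => mul_le_of_le_one_right (pow_nonneg hγ0 t) ?_
  rw [← sum_stateDist hP1 hπ1 hρ1 t]
  exact Finset.single_le_sum (fun x _ => hnn t x) (Finset.mem_univ s)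

theorem dvisit_nonneg (hγ0 : 0 ≤ γ) (hγ1 : γ < 1) (hP0 : ∀ s a s', 0 ≤ P s a s')
    (hρ0 : ∀ s, 0 ≤ ρ s) (hπ0 : ∀ s a, 0 ≤ π s a) (s : S) : 0 ≤ dvisit γ P π ρ s :=
  mul_nonneg (sub_nonneg.2 hγ1.le) <| tsum_nonneg fun t =>
    mul_nonneg (pow_nonneg hγ0 t) (stateDist_nonneg hP0 hπ0 hρ0 t s)

/-- The Bellman flow equation for the discounted state visitation distribution. -/
theorem dvisit_eq_add_sum (hγ0 : 0 ≤ γ) (hγ1 : γ < 1)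
    (hP0 : ∀ s a s', 0 ≤ P s a s') (hP1 : ∀ s a, ∑ s', P s a s' = 1)
    (hρ0 : ∀ s, 0 ≤ ρ s) (hρ1 : ∑ s, ρ s = 1)
    (hπ0 : ∀ s a, 0 ≤ π s a) (hπ1 : ∀ s, ∑ a, π s a = 1) (s' : S) :
    dvisit γ P π ρ s' =
      (1 - γ) * ρ s' + γ * ∑ s, ∑ a, dvisit γ P π ρ s * π s a * P s a s' := by
  have hs := summable_pow_mul_stateDist hγ0 hγ1 hP0 hP1 hρ0 hρ1 hπ0 hπ1
  have hstep : HasSum (fun t : ℕ => γ ^ (t + 1) * stateDist P π ρ (t + 1) s')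
      (∑ s, ∑ a, (∑' t : ℕ, γ ^ t * stateDist P π ρ t s) * (γ * π s a * P s a s')) := by
    refine (hasSum_sum fun s _ => hasSum_sum fun a _ =>
      (hs s).hasSum.mul_right (γ * π s a * P s a s')).congr_fun ?_
    intro t
    simp only [stateDist, Finset.mul_sum]
    exact Finset.sum_congr rfl fun s _ => Finset.sum_congr rfl fun a _ => by ring
  simp only [dvisit]
  rw [(hs s').tsum_eq_zero_add, hstep.tsum_eq]
  simp only [stateDist, pow_zero, one_mul, mul_add, Finset.mul_sum]
  congr 1
  exact Finset.sum_congr rfl fun s _ => Finset.sum_congr rfl fun a _ => by ring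

/-- The visitation distributions of two policies differ by at most `γ / (1 - γ)` times the
expected `ℓ¹` distance of the policies under the first visitation distribution. -/
theorem sum_abs_dvisit_sub_le {π' : S → A → ℝ} (hγ0 : 0 ≤ γ) (hγ1 : γ < 1)
    (hP0 : ∀ s a s', 0 ≤ P s a s') (hP1 : ∀ s a, ∑ s', P s a s' = 1)
    (hρ0 : ∀ s, 0 ≤ ρ s) (hρ1 : ∑ s, ρ s = 1)
    (hπ0 : ∀ s a, 0 ≤ π s a) (hπ1 : ∀ s, ∑ a, π s a = 1)
    (hπ'0 : ∀ s a, 0 ≤ π' s a) (hπ'1 : ∀ s, ∑ a, π' s a = 1) :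
    ∑ s, |dvisit γ P π ρ s - dvisit γ P π' ρ s|
      ≤ γ / (1 - γ) * ∑ s, dvisit γ P π ρ s * ∑ a, |π s a - π' s a| := by
  set d := dvisit γ P π ρ with hd
  set d' := dvisit γ P π' ρ with hd'
  have hdn : ∀ s, 0 ≤ d s := dvisit_nonneg hγ0 hγ1 hP0 hρ0 hπ0
  have hdiff (s' : S) : d s' - d' s' =
      γ * ∑ s, ∑ a, ((d s - d' s) * π' s a + d s * (π s a - π' s a)) * P s a s' := by
    rw [hd, hd', dvisit_eq_add_sum hγ0 hγ1 hP0 hP1 hρ0 hρ1 hπ0 hπ1 s',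
      dvisit_eq_add_sum hγ0 hγ1 hP0 hP1 hρ0 hρ1 hπ'0 hπ'1 s', ← hd, ← hd',
      add_sub_add_left_eq_sub, ← mul_sub, ← Finset.sum_sub_distrib]
    congr 1
    refine Finset.sum_congr rfl fun s _ => ?_
    rw [← Finset.sum_sub_distrib]
    exact Finset.sum_congr rfl fun a _ => by ring
  have hle : ∑ s, |d s - d' s| ≤
      γ * (∑ s, |d s - d' s| + ∑ s, d s * ∑ a, |π s a - π' s a|) :=
    calc ∑ s, |d s - d' s|
        = γ * ∑ s', |∑ s, ∑ a,
            ((d s - d' s) * π' s a + d s * (π s a - π' s a)) * P s a s'| := by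
          rw [Finset.mul_sum]
          exact Finset.sum_congr rfl fun s' _ => by rw [hdiff s', abs_mul, abs_of_nonneg hγ0]
      _ ≤ γ * ∑ s, ∑ a, |(d s - d' s) * π' s a + d s * (π s a - π' s a)| := by
          exact mul_le_mul_of_nonneg_left (sum_abs_sum_sum_mul_transition_le hP0 hP1 _) hγ0
      _ ≤ γ * ∑ s, ∑ a, (|d s - d' s| * π' s a + d s * |π s a - π' s a|) := by
          gcongr with s _ a _
          refine (abs_add_le _ _).trans_eq ?_
          rw [abs_mul, abs_mul, abs_of_nonneg (hπ'0 s a), abs_of_nonneg (hdn s)]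
      _ = _ := by simp only [Finset.sum_add_distrib, ← Finset.mul_sum, hπ'1, mul_one]
  rw [div_mul_eq_mul_div, le_div_iff₀ (sub_pos.2 hγ1)]
  linarith

end stateDist

/-- **Lemma 1 (state distribution discrepancy bound).**  For the behavior policy
`π^b(a|s) = T(s) π^g(a|s) + (1−T(s)) π^r(a|s)` induced by the intervention
function `T : S → [0,1]`, with weighted intervention rate
`β = E_{s∼d_{π^b}}[T(s)·‖π^g(·|s) − π^r(·|s)‖₁] / E_{s∼d_{π^b}}‖π^g(·|s) − π^r(·|s)‖₁`,
the discrepancy between the discounted state visitation distributions of `π^b`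
and `π^r` is bounded by
`‖d_{π^b} − d_{π^r}‖₁ ≤ (βγ/(1−γ)) · E_{s∼d_{π^b}}‖π^g(·|s) − π^r(·|s)‖₁`. -/
theorem state_distribution_discrepancy_bound
    {S A : Type*} [Fintype S] [Fintype A] [Nonempty S] [Nonempty A]
    (P : S → A → S → ℝ) (γ : ℝ) (ρ : S → ℝ)
    (hγ0 : 0 ≤ γ) (hγ1 : γ < 1)
    (hP0 : ∀ s a s', 0 ≤ P s a s') (hP1 : ∀ s a, ∑ s', P s a s' = 1)
    (hρ0 : ∀ s, 0 ≤ ρ s) (hρ1 : ∑ s, ρ s = 1)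
    (πg πr : S → A → ℝ)
    (hπg0 : ∀ s a, 0 ≤ πg s a) (hπg1 : ∀ s, ∑ a, πg s a = 1)
    (hπr0 : ∀ s a, 0 ≤ πr s a) (hπr1 : ∀ s, ∑ a, πr s a = 1)
    (T : S → ℝ) (hT0 : ∀ s, 0 ≤ T s) (hT1 : ∀ s, T s ≤ 1)
    (πb : S → A → ℝ)
    (hπb : ∀ s a, πb s a = T s * πg s a + (1 - T s) * πr s a)
    (hpos : 0 < ∑ s, dvisit γ P πb ρ s * ∑ a, |πg s a - πr s a|)
    (β : ℝ)
    (hβ : β = (∑ s, dvisit γ P πb ρ s * (T s * ∑ a, |πg s a - πr s a|)) /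
              (∑ s, dvisit γ P πb ρ s * ∑ a, |πg s a - πr s a|)) :
    ∑ s, |dvisit γ P πb ρ s - dvisit γ P πr ρ s|
      ≤ β * γ / (1 - γ) * ∑ s, dvisit γ P πb ρ s * ∑ a, |πg s a - πr s a| := by
  have hπb0 (s : S) (a : A) : 0 ≤ πb s a := by
    rw [hπb]
    exact add_nonneg (mul_nonneg (hT0 s) (hπg0 s a))
      (mul_nonneg (sub_nonneg.2 (hT1 s)) (hπr0 s a))
  have hπb1 (s : S) : ∑ a, πb s a = 1 := by
    simp [hπb, Finset.sum_add_distrib, ← Finset.mul_sum, hπg1, hπr1]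
  have hTV (s : S) : ∑ a, |πb s a - πr s a| = T s * ∑ a, |πg s a - πr s a| := by
    rw [Finset.mul_sum]
    refine Finset.sum_congr rfl fun a _ => ?_
    rw [show πb s a - πr s a = T s * (πg s a - πr s a) by rw [hπb]; ring, abs_mul,
      abs_of_nonneg (hT0 s)]
  refine (sum_abs_dvisit_sub_le hγ0 hγ1 hP0 hP1 hρ0 hρ1 hπb0 hπb1 hπr0 hπr1).trans_eq ?_
  simp only [hTV]
  rw [hβ]
  field_simp
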